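/- Refined small-r asymptotics of the subordinate solution: let m ≥ 1 be an integer and Q continuous on (0,1] with |Q(r)| ≤ C_Q r^m. If φ₀ ∈ C²((0,1]) satisfies −φ₀'' + (1/4)φ₀ − φ₀/(4 sinh²(r)) + Q²φ₀ = 0 on (0,1] and |φ₀(r)| ≤ C r^{1/2} for r ∈ (0,1], then there exist a constant c ∈ ℝ and C' > 0 such that |φ₀(r) − c·sinh^{1/2}(r)| ≤ C' r^{2m+2} for all r ∈ (0,1]. -/

import Mathlib

/- Refined small-r asymptotics of the subordinate solution φ₀. -/

open Set

noncomputable section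

/-- A function on `(0,1)` whose derivative is `O(r^n)` converges at `0` with rate `r^(n+1)`. -/
theorem exists_abs_sub_le_of_abs_deriv_le_pow {f f' : ℝ → ℝ} {K : ℝ} {n : ℕ}
    (hf : ∀ r ∈ Ioo (0 : ℝ) 1, HasDerivAt f (f' r) r)
    (hf' : ∀ r ∈ Ioo (0 : ℝ) 1, |f' r| ≤ K * r ^ n) :
    ∃ L : ℝ, ∀ r ∈ Ioo (0 : ℝ) 1, |f r - L| ≤ K * r ^ (n + 1) := by
  have hK : 0 ≤ K := by
    have h := (abs_nonneg _).trans (hf' (1 / 2) (by norm_num))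
    exact nonneg_of_mul_nonneg_left h (by positivity)
  have hLip : LipschitzOnWith (Real.toNNReal K) f (Ioo 0 1) := by
    refine (convex_Ioo (0 : ℝ) 1).lipschitzOnWith_of_nnnorm_hasDerivWithin_le
      (fun r hr => (hf r hr).hasDerivWithinAt) fun r hr => ?_
    rw [← NNReal.coe_le_coe, coe_nnnorm, Real.norm_eq_abs, Real.coe_toNNReal K hK]
    exact (hf' r hr).trans (mul_le_of_le_one_right hK (pow_le_one₀ hr.1.le hr.2.le))
  obtain ⟨g, hg, hfg⟩ := hLip.extend_real
  refine ⟨g 0, fun b hb => ?_⟩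
  have hlim : Filter.Tendsto (fun a => |f b - g a|) (nhdsWithin 0 (Ioi 0))
      (nhds |f b - g 0|) :=
    ((continuous_const.sub hg.continuous).abs.tendsto 0).mono_left nhdsWithin_le_nhds
  refine le_of_tendsto hlim ?_
  filter_upwards [Ioo_mem_nhdsGT hb.1] with a ha
  have hsub : ∀ x ∈ Icc a b, x ∈ Ioo (0 : ℝ) 1 := fun x hx =>
    ⟨ha.1.trans_le hx.1, hx.2.trans_lt hb.2⟩
  rw [← hfg (hsub a (left_mem_Icc.2 ha.2.le))]
  have hmvt := (convex_Icc a b).norm_image_sub_le_of_norm_hasDerivWithin_le (f := f) (f' := f')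
    (C := K * b ^ n) (fun x hx => (hf x (hsub x hx)).hasDerivWithinAt)
    (fun x hx => (hf' x (hsub x hx)).trans <| by
      have := (hsub x hx).1.le
      gcongr
      exact hx.2)
    (left_mem_Icc.2 ha.2.le) (right_mem_Icc.2 ha.2.le)
  rw [Real.norm_eq_abs, Real.norm_eq_abs, abs_of_pos (sub_pos.2 ha.2)] at hmvt
  calc |f b - f a| ≤ K * b ^ n * (b - a) := hmvt
    _ ≤ K * b ^ n * b := by
      have := hb.1.le
      gcongr
      linarith [ha.1]
    _ = K * b ^ (n + 1) := by ring

theorem hasDerivAt_sqrt_sinh {r : ℝ} (hr : 0 < r) :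
    HasDerivAt (fun x => √(Real.sinh x)) (Real.cosh r / (2 * √(Real.sinh r))) r :=
  (Real.hasDerivAt_sinh r).sqrt (Real.sinh_pos_iff.2 hr).ne'

theorem hasDerivAt_cosh_div_sqrt_sinh {r : ℝ} (hr : 0 < r) :
    HasDerivAt (fun x => Real.cosh x / (2 * √(Real.sinh x)))
      ((1 / 4 - 1 / (4 * Real.sinh r ^ 2)) * √(Real.sinh r)) r := by
  have hS := Real.sinh_pos_iff.2 hr
  have hs : 0 < √(Real.sinh r) := Real.sqrt_pos.2 hS
  refine ((Real.hasDerivAt_cosh r).div ((hasDerivAt_sqrt_sinh hr).const_mul 2)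
    (by positivity)).congr_deriv ?_
  have hsq : √(Real.sinh r) ^ 2 = Real.sinh r := Real.sq_sqrt hS.le
  have hc : Real.cosh r ^ 2 = Real.sinh r ^ 2 + 1 := Real.cosh_sq r
  generalize √(Real.sinh r) = s at *
  rw [← hsq] at hc ⊢
  field_simp
  rw [hc]
  ring

/-- `log (tanh (r/2))` is a primitive of `1 / sinh r`. -/
theorem hasDerivAt_log_sinh_sub_log_cosh_half {r : ℝ} (hr : 0 < r) :
    HasDerivAt (fun x => Real.log (Real.sinh (x / 2)) - Real.log (Real.cosh (x / 2)))
      (1 / Real.sinh r) r := by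
  have hS : 0 < Real.sinh (r / 2) := Real.sinh_pos_iff.2 (by positivity)
  have hC := Real.cosh_pos (r / 2)
  have hh : HasDerivAt (fun x : ℝ => x / 2) (1 / 2) r := (hasDerivAt_id r).div_const 2
  refine ((hh.sinh.log hS.ne').sub (hh.cosh.log hC.ne')).congr_deriv ?_
  have h2 : Real.sinh r = 2 * Real.sinh (r / 2) * Real.cosh (r / 2) := by
    rw [← Real.sinh_two_mul]; congr 1; ring
  rw [h2]
  have := Real.cosh_sq (r / 2)
  field_simp
  linarith

theorem tendsto_log_sinh_sub_log_cosh_half :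
    Filter.Tendsto (fun x => Real.log (Real.sinh (x / 2)) - Real.log (Real.cosh (x / 2)))
      (nhdsWithin 0 (Ioi 0)) Filter.atBot := by
  have hsinh : Filter.Tendsto (fun x : ℝ => Real.sinh (x / 2)) (nhdsWithin 0 (Ioi 0))
      (nhdsWithin 0 (Ioi 0)) := by
    refine tendsto_nhdsWithin_iff.2 ⟨?_, ?_⟩
    · have h : Continuous fun x : ℝ => Real.sinh (x / 2) := by fun_prop
      simpa using (h.tendsto 0).mono_left nhdsWithin_le_nhds
    · filter_upwards [self_mem_nhdsWithin] with x hx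
      exact Real.sinh_pos_iff.2 (half_pos hx)
  refine Filter.tendsto_atBot_mono (fun x => ?_) (Real.tendsto_log_nhdsGT_zero.comp hsinh)
  exact sub_le_self _ (Real.log_nonneg (Real.one_le_cosh _))

theorem sinh_le_two_mul {r : ℝ} (h0 : 0 ≤ r) (h1 : r ≤ 1) : Real.sinh r ≤ 2 * r := by
  have hp := abs_le.1 (Real.abs_exp_sub_one_le (x := r) (by rwa [abs_of_nonneg h0]))
  have hn := abs_le.1 (Real.abs_exp_sub_one_le (x := -r) (by rwa [abs_neg, abs_of_nonneg h0]))
  rw [abs_neg, abs_of_nonneg h0] at hn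
  rw [abs_of_nonneg h0] at hp
  rw [Real.sinh_eq]
  linarith [hp.2, hn.1]

theorem sqrt_sinh_le {r : ℝ} (h0 : 0 ≤ r) (h1 : r ≤ 1) : √(Real.sinh r) ≤ 2 * √r := by
  rw [Real.sqrt_le_left (by positivity), mul_pow, Real.sq_sqrt h0]
  linarith [sinh_le_two_mul h0 h1]

/-- **Refined small-`r` asymptotics of the subordinate solution:** if
`−φ₀'' + (1/4)φ₀ − φ₀/(4 sinh²r) + Q²φ₀ = 0` on `(0,1]` with `|Q(r)| ≤ C_Q r^m` and
`|φ₀(r)| ≤ C r^{1/2}`, then `φ₀(r) = c·sinh^{1/2}(r) + O(r^{2m+2})`. -/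
theorem phi0_refined_asymptotics
    (m : ℕ) (hm : 1 ≤ m)
    (Q : ℝ → ℝ) (hQcont : ContinuousOn Q (Set.Ioc 0 1))
    (C_Q : ℝ) (hQbd : ∀ r ∈ Set.Ioc (0:ℝ) 1, |Q r| ≤ C_Q * r ^ m)
    (φ₀ : ℝ → ℝ) (hφC2 : ContDiffOn ℝ 2 φ₀ (Set.Ioc 0 1))
    (hφeq : ∀ r ∈ Set.Ioc (0:ℝ) 1,
      -deriv (deriv φ₀) r + (1/4) * φ₀ r - φ₀ r / (4 * Real.sinh r ^ 2)
        + Q r ^ 2 * φ₀ r = 0)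
    (Cb : ℝ) (hφbd : ∀ r ∈ Set.Ioc (0:ℝ) 1, |φ₀ r| ≤ Cb * Real.sqrt r) :
    ∃ (c : ℝ) (C' : ℝ), 0 < C' ∧
      ∀ r ∈ Set.Ioc (0:ℝ) 1,
        |φ₀ r - c * Real.sqrt (Real.sinh r)| ≤ C' * r ^ (2 * m + 2) := by
  have hIoc : ∀ r ∈ Ioo (0 : ℝ) 1, r ∈ Ioc (0 : ℝ) 1 := fun r hr => ⟨hr.1, hr.2.le⟩
  have hCb : 0 ≤ Cb := by
    simpa using (abs_nonneg _).trans (hφbd 1 (by norm_num))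
  have hC2 : ContDiffOn ℝ 2 φ₀ (Ioo 0 1) := hφC2.mono hIoc
  have hφ : ∀ r ∈ Ioo (0 : ℝ) 1, HasDerivAt φ₀ (deriv φ₀ r) r := fun r hr =>
    ((hC2.differentiableOn (by norm_num)).differentiableAt (isOpen_Ioo.mem_nhds hr)).hasDerivAt
  have hφ' : ∀ r ∈ Ioo (0 : ℝ) 1, HasDerivAt (deriv φ₀) (deriv (deriv φ₀) r) r := fun r hr =>
    (((hC2.deriv_of_isOpen isOpen_Ioo (m := 1) (by norm_num)).differentiableOn
      (by norm_num)).differentiableAt (isOpen_Ioo.mem_nhds hr)).hasDerivAt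
  set s : ℝ → ℝ := fun x => √(Real.sinh x) with hs_def
  set s' : ℝ → ℝ := fun x => Real.cosh x / (2 * √(Real.sinh x)) with hs'_def
  set ℓ : ℝ → ℝ :=
    fun x => Real.log (Real.sinh (x / 2)) - Real.log (Real.cosh (x / 2)) with hℓ_def
  set K : ℝ := 2 * Cb * C_Q ^ 2 with hK_def
  have hK : 0 ≤ K := by positivity
  have hs_pos : ∀ r, 0 < r → 0 < s r := fun r hr => Real.sqrt_pos.2 (Real.sinh_pos_iff.2 hr)
  have hs_sq : ∀ r, 0 < r → s r ^ 2 = Real.sinh r := fun r hr =>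
    Real.sq_sqrt (Real.sinh_pos_iff.2 hr).le
  -- The Wronskian of `s` and `φ₀` has derivative `s Q² φ₀`.
  have hW : ∀ r ∈ Ioo (0 : ℝ) 1, HasDerivAt (fun x => s x * deriv φ₀ x - s' x * φ₀ x)
      (s r * (Q r ^ 2 * φ₀ r)) r := fun r hr => by
    refine (((hasDerivAt_sqrt_sinh hr.1).mul (hφ' r hr)).sub
      ((hasDerivAt_cosh_div_sqrt_sinh hr.1).mul (hφ r hr))).congr_deriv ?_
    have h : deriv (deriv φ₀) r = (1 / 4) * φ₀ r - φ₀ r / (4 * Real.sinh r ^ 2)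
        + Q r ^ 2 * φ₀ r := by linarith [hφeq r (hIoc r hr)]
    rw [h]
    simp only [hs_def]
    ring
  have hW' : ∀ r ∈ Ioo (0 : ℝ) 1, |s r * (Q r ^ 2 * φ₀ r)| ≤ K * r ^ (2 * m + 1) := fun r hr => by
    have hr0 := hr.1.le
    rw [abs_mul, abs_mul, abs_of_pos (hs_pos r hr.1), abs_pow]
    calc s r * (|Q r| ^ 2 * |φ₀ r|)
        ≤ (2 * √r) * ((C_Q * r ^ m) ^ 2 * (Cb * √r)) := by
          gcongr
          · exact sqrt_sinh_le hr0 hr.2.le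
          · exact hQbd r (hIoc r hr)
          · exact hφbd r (hIoc r hr)
      _ = K * r ^ (2 * m) * (√r * √r) := by rw [hK_def]; ring
      _ = K * r ^ (2 * m + 1) := by rw [Real.mul_self_sqrt hr0]; ring
  obtain ⟨L, hL⟩ := exists_abs_sub_le_of_abs_deriv_le_pow hW hW'
  have hv : ∀ r ∈ Ioo (0 : ℝ) 1, HasDerivAt (fun x => φ₀ x / s x - L * ℓ x)
      ((s r * deriv φ₀ r - s' r * φ₀ r - L) / Real.sinh r) r := fun r hr => by
    refine (((hφ r hr).div (hasDerivAt_sqrt_sinh hr.1) (hs_pos r hr.1).ne').sub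
      ((hasDerivAt_log_sinh_sub_log_cosh_half hr.1).const_mul L)).congr_deriv ?_
    have h : √(Real.sinh r) ^ 2 = Real.sinh r := hs_sq r hr.1
    rw [h]
    simp only [hs_def, hs'_def]
    ring
  have hv' : ∀ r ∈ Ioo (0 : ℝ) 1,
      |(s r * deriv φ₀ r - s' r * φ₀ r - L) / Real.sinh r| ≤ K * r ^ (2 * m + 1) := fun r hr => by
    have hS := Real.sinh_pos_iff.2 hr.1
    have hr0 := hr.1.le
    rw [abs_div, abs_of_pos hS, div_le_iff₀ hS]
    calc _ ≤ K * r ^ (2 * m + 1 + 1) := hL r hr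
      _ = K * r ^ (2 * m + 1) * r := by ring
      _ ≤ _ := by gcongr; exact Real.self_le_sinh_iff.2 hr0
  obtain ⟨c, hc⟩ := exists_abs_sub_le_of_abs_deriv_le_pow hv hv'
  -- A nonzero `L` would make `φ₀ / s` diverge logarithmically.
  have hL0 : L = 0 := by
    by_contra hne
    have hev := (tendsto_log_sinh_sub_log_cosh_half.eventually_lt_atBot
      (-((K + |c| + Cb) / |L|))).and (Ioo_mem_nhdsGT (zero_lt_one (α := ℝ)))
    obtain ⟨r, hrℓ, hr⟩ := hev.exists
    change ℓ r < _ at hrℓ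
    have hLpos := abs_pos.2 hne
    have hw : |φ₀ r / s r| ≤ Cb := by
      rw [abs_div, abs_of_pos (hs_pos r hr.1), div_le_iff₀ (hs_pos r hr.1)]
      refine (hφbd r (hIoc r hr)).trans ?_
      gcongr
      exact Real.sqrt_le_sqrt (Real.self_le_sinh_iff.2 hr.1.le)
    have hvr : |φ₀ r / s r - L * ℓ r - c| ≤ K :=
      (hc r hr).trans (mul_le_of_le_one_right hK (pow_le_one₀ hr.1.le hr.2.le))
    have hbd : |L * ℓ r| ≤ K + |c| + Cb := by
      have h1 := abs_le.1 hw
      have h2 := abs_le.1 hvr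
      have h3 := neg_abs_le c
      have h4 := le_abs_self c
      exact abs_le.2 ⟨by linarith, by linarith⟩
    have hgt : (K + |c| + Cb) / |L| < |ℓ r| := by
      linarith [neg_abs_le (ℓ r)]
    rw [div_lt_iff₀ hLpos] at hgt
    rw [abs_mul] at hbd
    linarith
  refine ⟨c, 2 * K + |φ₀ 1 - c * s 1| + 1, by positivity, fun r hr => ?_⟩
  have hr0 := hr.1.le
  rcases hr.2.lt_or_eq with hr1 | rfl
  · have hsr := hs_pos r hr.1
    have h := hc r ⟨hr.1, hr1⟩
    simp only [hL0, zero_mul, sub_zero] at h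
    have hs2 : s r ≤ 2 := by
      refine (sqrt_sinh_le hr0 hr.2).trans ?_
      linarith [Real.sqrt_le_one.2 hr.2]
    calc |φ₀ r - c * s r| = s r * |φ₀ r / s r - c| := by
          rw [← abs_of_pos hsr, ← abs_mul, abs_of_pos hsr]
          congr 1
          field_simp
      _ ≤ 2 * (K * r ^ (2 * m + 1 + 1)) := by gcongr
      _ = 2 * K * r ^ (2 * m + 2) := by ring
      _ ≤ _ := by
          gcongr
          linarith [abs_nonneg (φ₀ 1 - c * s 1)]
  · rw [one_pow, mul_one]
    change |φ₀ 1 - c * s 1| ≤ _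
    linarith

end
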